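/- Define G_N(a,b;q) = ∑_{j≥0} q^{3·binom(N-2j,2)} C(N,2j)_{q^3} (-a q^4; q^6)_j (-b q^2; q^6)_j (a finite sum). Then G_N satisfies the recurrence G_{N+1} = (1 + q^{3N}) G_N + (b q^{3N-1} + a q^{3N+1} + a b q^{6N}) G_{N-1} + a b q^{6N-3}(1 - q^{3N-3}) G_{N-2} for N ≥ 2, with G_0 = G_1 = 1 and G_2 = 1 + b q^2 + q^3 + a q^4 + a b q^6. -/

import Mathlib

open Finset

/-- q-Pochhammer symbol (a;q)_n. -/
noncomputable def qPoch {K : Type*} [Field K] (q a : K) (n : ℕ) : K :=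
  ∏ j ∈ Finset.range n, (1 - a * q ^ j)

/-- Gaussian (q-)binomial coefficient. -/
noncomputable def qbinom {K : Type*} [Field K] (q : K) (n k : ℕ) : K :=
  if k ≤ n then qPoch q q n / (qPoch q q k * qPoch q q (n - k)) else 0

section AAG
variable {K : Type*} [Field K]

lemma qPoch_succ' (q a : K) (n : ℕ) : qPoch q a (n+1) = qPoch q a n * (1 - a * q ^ n) := by
  simp [qPoch, Finset.prod_range_succ]

lemma qPoch_ne (p : K) (h : ∀ n : ℕ, 1 - p * p ^ n ≠ 0) (n : ℕ) : qPoch p p n ≠ 0 := by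
  unfold qPoch
  exact Finset.prod_ne_zero_iff.2 fun i _ => h i

noncomputable def cc (p : K) (N j : ℕ) : K :=
  p ^ ((N - 2 * j) * (N - 2 * j - 1) / 2) * qbinom p N (2 * j)

lemma cc_zero (p : K) (N j : ℕ) (h : N < 2 * j) : cc p N j = 0 := by
  simp [cc, qbinom, Nat.not_le.2 h]

lemma cc_eq (p : K) (N j r : ℕ) (h : N = 2 * j + r) :
    cc p N j = p ^ (r.choose 2) * (qPoch p p (2*j+r) / (qPoch p p (2*j) * qPoch p p r)) := by
  subst h
  simp [cc, qbinom, Nat.choose_two_right]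

lemma ch1 (s : ℕ) : (s+1).choose 2 = s.choose 2 + s := by
  rw [Nat.choose_succ_succ' s 1]; simp [add_comm]

lemma E2 (p : K) (h : ∀ n : ℕ, 1 - p * p ^ n ≠ 0) (L j : ℕ) :
    (p ^ (L+1) * p ^ (2*j) - p ^ (2*(L+1))) * cc p (L+1) j
      = p ^ (2*L+1) * (1 - p ^ (L+1)) * cc p L j := by
  rcases lt_trichotomy (2*j) (L+1) with h1 | h1 | h1
  · obtain ⟨r, rfl⟩ : ∃ r, L = 2*j+r := ⟨L - 2*j, by omega⟩
    rw [cc_eq p _ j r rfl, cc_eq p _ j (r+1) (by ring), ← add_assoc, qPoch_succ', qPoch_succ', ch1]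
    have a1 := qPoch_ne p h (2*j)
    have a2 := qPoch_ne p h r
    have a3 := h r
    field_simp
    ring
  · rw [cc_zero p L j (by omega), h1]; ring
  · rw [cc_zero p L j (by omega), cc_zero p (L+1) j (by omega)]; ring

lemma E1 (p : K) (h : ∀ n : ℕ, 1 - p * p ^ n ≠ 0) (M j : ℕ) :
    p ^ (2*j+2) * cc p (M+2) (j+1) = p ^ (2*j+2) * (1 + p ^ (M+1)) * cc p (M+1) (j+1)
      + p ^ M * (p ^ 2 * cc p M j - cc p M (j+1)) := by
  by_cases h1 : M < 2 * j
  · simp (disch := omega) [cc_zero]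
  obtain ⟨r, rfl⟩ : ∃ r, M = 2*j+r := ⟨M - 2*j, by omega⟩
  have a1 := qPoch_ne p h (2*j)
  have b0 := h (2*j)
  have b1 := h (2*j+1)
  match r with
  | 0 =>
    rw [cc_zero p (2*j+0) (j+1) (by omega), cc_zero p (2*j+0+1) (j+1) (by omega),
      cc_eq p (2*j+0+2) (j+1) 0 (by ring), cc_eq p _ j 0 rfl]
    have e : 2*(j+1) = 2*j+1+1 := by ring
    simp only [e, add_zero, qPoch_succ']
    have : qPoch p p 0 = 1 := by simp [qPoch]
    rw [this]
    field_simp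
    simp; ring
  | 1 =>
    rw [cc_zero p (2*j+1) (j+1) (by omega), cc_eq p (2*j+1+1) (j+1) 0 (by ring),
      cc_eq p (2*j+1+2) (j+1) 1 (by ring), cc_eq p _ j 1 rfl]
    have e : 2*(j+1) = 2*j+1+1 := by ring
    simp only [e, add_zero, qPoch_succ']
    have : qPoch p p 0 = 1 := by simp [qPoch]
    have t1 : qPoch p p 1 = 1 - p := by simp [qPoch]
    have h0 := h 0
    rw [pow_zero, mul_one] at h0
    rw [this, pow_zero, mul_one, one_mul]
    field_simp
    simp; ring
  | s+2 =>
    rw [cc_eq p (2*j+(s+2)+2) (j+1) (s+2) (by ring), cc_eq p (2*j+(s+2)+1) (j+1) (s+1) (by ring),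
      cc_eq p (2*j+(s+2)) (j+1) s (by ring), cc_eq p _ j (s+2) rfl]
    have e : 2*(j+1) = 2*j+1+1 := by ring
    have e1 : 2*j+1+1+(s+2) = 2*j+(s+2)+1+1 := by ring
    have e2 : 2*j+1+1+(s+1) = 2*j+(s+2)+1 := by ring
    have e3 : 2*j+1+1+s = 2*j+(s+2) := by ring
    have e4 : s + 2 = s+1+1 := rfl
    rw [e, e1, e2, e3, qPoch_succ' p p (2*j+(s+2)+1), qPoch_succ' p p (2*j+(s+2)),
      qPoch_succ' p p (2*j+1), qPoch_succ' p p (2*j)]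
    generalize qPoch p p (2*j+(s+2)) = X
    rw [e4, qPoch_succ' p p (s+1), qPoch_succ' p p s, ch1 (s+1), ch1 s]
    have a2 := qPoch_ne p h s
    have a3 := h s
    have a4 := h (s+1)
    field_simp
    ring

noncomputable def PP (p A B : K) (j : ℕ) : K := qPoch (p^2) (-A) j * qPoch (p^2) (-B) j

lemma PP_succ (p A B : K) (j : ℕ) :
    PP p A B (j+1) = PP p A B j * (1 + (A+B) * p^(2*j) + A*B*p^(4*j)) := by
  simp only [PP, qPoch_succ']; ring

lemma tele (p A B : K) (hp : p ≠ 0) (h : ∀ n : ℕ, 1 - p * p ^ n ≠ 0) (L n : ℕ) :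
    p ^ (2*n) * ∑ j ∈ range (n+1), (-cc p (L+3) j + (1 + p^(L+2)) * cc p (L+2) j
      + (p^(L+1) * (A+B) + A*B*p^(2*(L+1))) * cc p (L+1) j
      + A*B*p^(2*L+1)*(1-p^(L+1)) * cc p L j) * PP p A B j
      = p^(L+1) * cc p (L+1) n * PP p A B (n+1) := by
  induction n with
  | zero =>
    have h2 := E2 p h L 0
    rw [zero_add, sum_range_one, PP_succ]
    have e (N : ℕ) : cc p N 0 = p ^ (N.choose 2) := by
      rw [cc_eq p N 0 N (by simp)]
      have := qPoch_ne p h N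
      have t : qPoch p p 0 = 1 := by simp [qPoch]
      simp [t, this]
    have h3 : cc p (L+3) 0 = p^(L+2) * cc p (L+2) 0 := by
      rw [e, e, ch1 (L+2)]; ring
    have h4 : cc p (L+2) 0 = p^(L+1) * cc p (L+1) 0 := by
      rw [e, e, ch1 (L+1)]; ring
    simp only [mul_zero, pow_zero] at h2 ⊢
    linear_combination (-PP p A B 0) * h3 + PP p A B 0 * h4 - A * B * PP p A B 0 * h2
  | succ n ih =>
    rw [sum_range_succ, mul_add]
    have h1 := E1 p h (L+1) n
    have h2 := E2 p h L (n+1)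
    rw [PP_succ p A B (n+1)]
    rw [show 2*(n+1) = 2*n+2 by ring] at *
    rw [show 4*(n+1) = (2*n+2)+(2*n+2) by ring, pow_add p (2*n+2) (2*n+2)]
    linear_combination p^2 * ih - PP p A B (n+1) * h1 - A * B * p^(2*n+2) * PP p A B (n+1) * h2

noncomputable def GG (p A B : K) (N : ℕ) : K := ∑ j ∈ range (N+1), cc p N j * PP p A B j

lemma GG_ext (p A B : K) (N m : ℕ) (h : N ≤ m) :
    GG p A B N = ∑ j ∈ range (m+1), cc p N j * PP p A B j := by
  unfold GG
  apply sum_subset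
  · intro x; simp only [mem_range]; omega
  · intro x _ hx
    simp only [mem_range] at hx
    rw [cc_zero p N x (by omega), zero_mul]

lemma GG_rec (p A B : K) (hp : p ≠ 0) (h : ∀ n : ℕ, 1 - p * p ^ n ≠ 0) (L : ℕ) :
    GG p A B (L+3) = (1 + p^(L+2)) * GG p A B (L+2)
      + (p^(L+1) * (A+B) + A*B*p^(2*(L+1))) * GG p A B (L+1)
      + A*B*p^(2*L+1)*(1-p^(L+1)) * GG p A B L := by
  have t := tele p A B hp h L (L+3)
  rw [cc_zero p (L+1) (L+3) (by omega), mul_zero, zero_mul] at t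
  have t := (mul_eq_zero.1 t).resolve_left (pow_ne_zero _ hp)
  simp only [add_mul, sum_add_distrib, neg_mul, sum_neg_distrib, mul_assoc, ← mul_sum] at t
  rw [GG_ext p A B (L+3) (L+3) (by omega), GG_ext p A B (L+2) (L+3) (by omega),
    GG_ext p A B (L+1) (L+3) (by omega), GG_ext p A B L (L+3) (by omega)]
  simp only [add_mul, mul_assoc]
  linear_combination -t

end AAG

/-- The Alladi--Andrews--Gordon generating function G_N(a,b;q) and its recurrence,
with a = X 0, b = X 1, q = X 2 indeterminates. -/
theorem AAG_recurrence (a b q : FractionRing (MvPolynomial (Fin 3) ℚ))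
    (ha : a = algebraMap (MvPolynomial (Fin 3) ℚ) _ (MvPolynomial.X 0))
    (hb : b = algebraMap (MvPolynomial (Fin 3) ℚ) _ (MvPolynomial.X 1))
    (hq : q = algebraMap (MvPolynomial (Fin 3) ℚ) _ (MvPolynomial.X 2))
    (G : ℕ → FractionRing (MvPolynomial (Fin 3) ℚ))
    (hG : ∀ N : ℕ, G N = ∑ j ∈ Finset.range (N + 1),
      q ^ (3 * ((N - 2 * j) * (N - 2 * j - 1) / 2)) * qbinom (q ^ 3) N (2 * j) *
        qPoch (q ^ 6) (-(a * q ^ 4)) j * qPoch (q ^ 6) (-(b * q ^ 2)) j) :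
    G 0 = 1 ∧ G 1 = 1 ∧ G 2 = 1 + b * q ^ 2 + q ^ 3 + a * q ^ 4 + a * b * q ^ 6 ∧
      ∀ N : ℕ, 2 ≤ N →
        G (N + 1) = (1 + q ^ (3 * N)) * G N
          + (b * q ^ (3 * N - 1) + a * q ^ (3 * N + 1) + a * b * q ^ (6 * N)) * G (N - 1)
          + a * b * q ^ (6 * N - 3) * (1 - q ^ (3 * N - 3)) * G (N - 2) := by
  have hinj := IsFractionRing.injective (MvPolynomial (Fin 3) ℚ) (FractionRing (MvPolynomial (Fin 3) ℚ))
  have hq0 : q ≠ 0 := by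
    rw [hq]
    exact fun h => MvPolynomial.X_ne_zero (R := ℚ) (2 : Fin 3) (hinj (h.trans (map_zero _).symm))
  have hp : q ^ 3 ≠ 0 := pow_ne_zero _ hq0
  have hn : ∀ n : ℕ, 1 - q ^ 3 * (q ^ 3) ^ n ≠ 0 := by
    intro n h0
    have h1 : algebraMap (MvPolynomial (Fin 3) ℚ) (FractionRing (MvPolynomial (Fin 3) ℚ))
        (1 - MvPolynomial.X 2 ^ 3 * (MvPolynomial.X 2 ^ 3) ^ n) = algebraMap _ _ 0 := by
      rw [map_zero, ← h0, hq]; simp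
    have h2 := congrArg (MvPolynomial.eval (fun _ => (0 : ℚ))) (hinj h1)
    simp at h2
  have hGG : ∀ N, G N = GG (q ^ 3) (a * q ^ 4) (b * q ^ 2) N := by
    intro N
    rw [hG]
    apply Finset.sum_congr rfl
    intro j _
    rw [cc, PP, pow_mul q 3, show (q ^ 3) ^ 2 = q ^ 6 by ring]
    ring
  clear hG
  have c0 : ∀ N, cc (q ^ 3) N 0 = (q ^ 3) ^ (N.choose 2) := by
    intro N
    rw [cc_eq _ N 0 N (by simp)]
    have := qPoch_ne _ hn N
    have t : qPoch (q ^ 3) (q ^ 3) 0 = 1 := by simp [qPoch]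
    simp [t, this]
  have c2 : cc (q ^ 3) 2 1 = 1 := by
    rw [cc_eq _ 2 1 0 rfl]
    have := qPoch_ne _ hn 2
    have t : qPoch (q ^ 3) (q ^ 3) 0 = 1 := by simp [qPoch]
    simp [t, this]
  have P0 : PP (q ^ 3) (a * q ^ 4) (b * q ^ 2) 0 = 1 := by simp [PP, qPoch]
  refine ⟨?_, ?_, ?_, ?_⟩
  · rw [hGG, GG, Finset.sum_range_one, c0, P0]; simp
  · rw [hGG, GG, Finset.sum_range_succ, Finset.sum_range_one, c0, P0,
      cc_zero _ 1 1 (by omega)]; simp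
  · rw [hGG, GG, Finset.sum_range_succ, Finset.sum_range_succ, Finset.sum_range_one, c0,
      cc_zero _ 2 2 (by omega), PP_succ, P0, c2]
    simp; ring
  · intro N hN
    obtain ⟨L, rfl⟩ : ∃ L, N = L + 2 := ⟨N - 2, by omega⟩
    rw [show L + 2 - 1 = L + 1 by omega, show L + 2 - 2 = L by omega,
      show 3 * (L + 2) - 1 = 3 * L + 5 by omega, show 6 * (L + 2) - 3 = 6 * L + 9 by omega,
      show 3 * (L + 2) - 3 = 3 * L + 3 by omega]
    simp only [hGG]
    rw [GG_rec _ _ _ hp hn L]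
    ring
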